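/- arXiv:1701.03580 — 13 statements merged into one kernel-verified Lean document; each statement's English description precedes it below -/
import Mathlib

section
/- Let x₁, x₂ ∈ ℝ and v₁, v₂ ≥ 0 satisfy x₁ − x₂ ≥ D(v₁, v₂). Then for every t ≥ 0 the simultaneous maximum-braking trajectories satisfy p(x₁, v₁, t) − p(x₂, v₂, t) ≥ L. That is, D defined by D(v₁, v₂) = L + max{0, (v₂² − v₁²)/(−2u_m)} is a safe-following distance: if both vehicles brake maximally, they remain separated by at least a vehicle length until they stop. -/
/-- Safe-following distance: `D(v₁, v₂) = L + max {0, (v₂² − v₁²)/(−2 u_m)}`. -/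
noncomputable def Dsafe (um L v₁ v₂ : ℝ) : ℝ :=
  L + max 0 ((v₂ ^ 2 - v₁ ^ 2) / (-2 * um))

/-- Maximum-braking trajectory from position `x` with initial speed `v`:
`p(x, v, t) = x + v t + u_m t²/2` for `t ≤ −v/u_m`, and the stopping position thereafter. -/
noncomputable def mbm (um x v t : ℝ) : ℝ :=
  if t ≤ -v / um then x + v * t + um * t ^ 2 / 2 else x + v ^ 2 / (-2 * um)

/-- The braking trajectory in terms of the current speed `max 0 (v + u_m t)`. -/
theorem mbm_eq_add_sq_sub_sq_div {um : ℝ} (hum : um < 0) (x v t : ℝ) :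
    mbm um x v t = x + (v ^ 2 - (max 0 (v + um * t)) ^ 2) / (-2 * um) := by
  have hne : um ≠ 0 := hum.ne
  have hiff : t ≤ -v / um ↔ 0 ≤ v + um * t := by
    rw [le_div_iff_of_neg hum]
    constructor <;> intro h <;> linarith
  unfold mbm
  split_ifs with h
  · rw [max_eq_right (hiff.mp h)]
    field_simp
    ring
  · rw [max_eq_left (not_le.mp (mt hiff.mpr h)).le]
    ring

/-- Among vehicles braking for the same time, the faster one loses more squared speed. -/
theorem sq_sub_max_sq_mono {s v w : ℝ} (hs : s ≤ 0) (hv : 0 ≤ v) (hvw : v ≤ w) :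
    v ^ 2 - (max 0 (v + s)) ^ 2 ≤ w ^ 2 - (max 0 (w + s)) ^ 2 := by
  rcases max_cases 0 (v + s) with ⟨h₁, h₁'⟩ | ⟨h₁, h₁'⟩ <;>
    rcases max_cases 0 (w + s) with ⟨h₂, h₂'⟩ | ⟨h₂, h₂'⟩ <;>
    rw [h₁, h₂] <;> nlinarith

/-- `D` is a safe-following distance: if `x₁ − x₂ ≥ D(v₁, v₂)` then under
simultaneous maximum braking the vehicles remain separated by at least `L` for all `t ≥ 0`. -/
theorem safe_following_distance_is_safe
    (um L : ℝ) (hum : um < 0) (hL : 0 < L)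
    (x₁ x₂ v₁ v₂ : ℝ) (hv₁ : 0 ≤ v₁) (hv₂ : 0 ≤ v₂)
    (hsep : x₁ - x₂ ≥ Dsafe um L v₁ v₂) :
    ∀ t : ℝ, 0 ≤ t → mbm um x₁ v₁ t - mbm um x₂ v₂ t ≥ L := by
  intro t ht
  have hpos : 0 < -2 * um := by linarith
  rw [mbm_eq_add_sq_sub_sq_div hum, mbm_eq_add_sq_sub_sq_div hum]
  unfold Dsafe at hsep
  rcases le_total v₂ v₁ with h | h
  · have hmono := div_le_div_of_nonneg_right
      (sq_sub_max_sq_mono (mul_nonpos_of_nonpos_of_nonneg hum.le ht) hv₂ h) hpos.le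
    have hmax := le_max_left 0 ((v₂ ^ 2 - v₁ ^ 2) / (-2 * um))
    linarith
  · have hspeed : (max 0 (v₁ + um * t)) ^ 2 ≤ (max 0 (v₂ + um * t)) ^ 2 := by
      gcongr
    have hdiv := div_le_div_of_nonneg_right hspeed hpos.le
    have hmax := le_max_right 0 ((v₂ ^ 2 - v₁ ^ 2) / (-2 * um))
    simp only [sub_div] at hsep hmax ⊢
    linarith
end

section
/- Let x₁, x₂ ∈ ℝ and v₂ ≥ v₁ ≥ 0. Then for every t ≥ 0, p(x₁, v₁, t) − p(x₂, v₂, t) ≥ (x₁ − x₂) − (v₂² − v₁²)/(−2u_m). That is, under simultaneous maximum braking the gap between the leading and the following vehicle is always at least the gap between their final stopping positions. -/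
/-- The position is the stopping position minus the distance still to be covered. -/
lemma mbm_eq_stop_sub_remaining {um : ℝ} (hum : um < 0) (x v t : ℝ) :
    mbm um x v t = x + v ^ 2 / (-2 * um) - max (v + um * t) 0 ^ 2 / (-2 * um) := by
  have hne : um ≠ 0 := hum.ne
  have hiff : t ≤ -v / um ↔ 0 ≤ v + um * t := by
    rw [le_div_iff_of_neg hum]
    constructor <;> intro h <;> linarith
  unfold mbm
  split_ifs with h
  · rw [max_eq_left (hiff.1 h)]
    field_simp
    ring
  · rw [max_eq_right (not_le.1 (mt hiff.2 h)).le]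
    simp

/-- under simultaneous maximum braking, if the follower is at least as fast as
the leader, the gap is always at least the gap between the final stopping positions. -/
theorem mbm_gap_lower_bound_when_follower_faster
    (um : ℝ) (hum : um < 0)
    (x₁ x₂ v₁ v₂ : ℝ) (hv₁ : 0 ≤ v₁) (hv : v₁ ≤ v₂) :
    ∀ t : ℝ, 0 ≤ t →
      mbm um x₁ v₁ t - mbm um x₂ v₂ t ≥ (x₁ - x₂) - (v₂ ^ 2 - v₁ ^ 2) / (-2 * um) := by
  intro t _
  have hpos : 0 < -2 * um := by linarith
  have hmono : max (v₁ + um * t) 0 ^ 2 / (-2 * um) ≤ max (v₂ + um * t) 0 ^ 2 / (-2 * um) := by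
    gcongr
  rw [mbm_eq_stop_sub_remaining hum, mbm_eq_stop_sub_remaining hum, sub_div]
  linarith
end

section
/- Let d ≥ 0 and v ∈ [0, v^M]. Then 𝒯(d, v) is the least element of the set of times T ≥ 0 for which there exists a measurable control u : [0, T] → ℝ with u(t) ∈ [u_m, u_M] for all t ∈ [0, T], such that the speed w(t) = v + ∫₀ᵗ u(s) ds satisfies w(t) ∈ [0, v^M] for all t ∈ [0, T] and the position x(t) = −d + ∫₀ᵗ w(s) ds satisfies x(T) = 0. In other words, 𝒯(d, v) is exactly the minimum time needed to traverse a distance d starting at speed v under the acceleration bounds and the speed limit, achieved by maximal acceleration until the speed limit and coasting thereafter. -/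
open intervalIntegral

/-- Minimum time to traverse distance `d` starting at speed `v` under acceleration bound
`u_M` and speed limit `v^M`. -/
noncomputable def Tc (uM vM d v : ℝ) : ℝ :=
  if 2 * uM * d ≤ vM ^ 2 - v ^ 2 then (Real.sqrt (2 * uM * d + v ^ 2) - v) / uM
  else (vM - v) / uM + (2 * uM * d - vM ^ 2 + v ^ 2) / (2 * uM * vM)

/-- A measurable function with bounded values on `[a, b]` is interval integrable there. -/
theorem intervalIntegrable_of_measurable_of_mem_Icc {u : ℝ → ℝ} {a b m M : ℝ} (hab : a ≤ b)
    (hu : Measurable u) (hb : ∀ t ∈ Set.Icc a b, u t ∈ Set.Icc m M) :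
    IntervalIntegrable u MeasureTheory.volume a b := by
  rw [intervalIntegrable_iff_integrableOn_Icc_of_le hab]
  refine MeasureTheory.Measure.integrableOn_of_bounded (M := max |m| |M|)
    measure_Icc_lt_top.ne hu.aestronglyMeasurable ?_
  filter_upwards [MeasureTheory.ae_restrict_mem measurableSet_Icc] with t ht
  exact abs_le_max_abs_abs (hb t ht).1 (hb t ht).2

theorem integral_affine (v c a b : ℝ) :
    ∫ s in a..b, (v + c * s) = v * (b - a) + c * (b ^ 2 - a ^ 2) / 2 := by
  rw [intervalIntegral.integral_add intervalIntegrable_const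
    ((continuous_const_mul c).intervalIntegrable _ _), intervalIntegral.integral_const_mul]
  simp only [intervalIntegral.integral_const, integral_id, smul_eq_mul]
  ring

/-- Speed gained by accelerating at rate `c` until time `a` and coasting thereafter. -/
theorem integral_bangCoast (c : ℝ) {a t : ℝ} (ha : 0 ≤ a) (ht : 0 ≤ t) :
    ∫ s in (0 : ℝ)..t, (if s ≤ a then c else 0) = c * min t a := by
  have before : ∀ b, 0 ≤ b → b ≤ a →
      ∫ s in (0 : ℝ)..b, (if s ≤ a then c else 0) = c * b := by
    intro b hb hba
    have : Set.EqOn (fun s ↦ if s ≤ a then c else 0) (fun _ ↦ c) (Set.uIcc 0 b) := by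
      intro s hs
      rw [Set.uIcc_of_le hb] at hs
      simp [hs.2.trans hba]
    rw [intervalIntegral.integral_congr this]
    simp [mul_comm]
  rcases le_total t a with h | h
  · rw [min_eq_left h, before t ht h]
  · have hm : Measurable fun s : ℝ ↦ if s ≤ a then c else 0 :=
      Measurable.ite measurableSet_Iic measurable_const measurable_const
    have hint : ∀ x y : ℝ, x ≤ y →
        IntervalIntegrable (fun s : ℝ ↦ if s ≤ a then c else 0) MeasureTheory.volume x y := by
      intro x y hxy
      refine intervalIntegrable_of_measurable_of_mem_Icc (m := min c 0) (M := max c 0) hxy hm ?_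
      intro s _
      split_ifs <;> simp
    have after : ∫ s in a..t, (if s ≤ a then c else 0) = 0 := by
      apply intervalIntegral.integral_zero_ae
      filter_upwards with s hs
      rw [Set.uIoc_of_le h] at hs
      simp [not_le.2 hs.1]
    rw [min_eq_right h, ← intervalIntegral.integral_add_adjacent_intervals (hint 0 a ha)
      (hint a t h), before a ha le_rfl, after, add_zero]

/-- Distance covered by accelerating at rate `c` until time `a` and coasting thereafter. -/
theorem integral_affine_min (v c : ℝ) {a T : ℝ} (ha : 0 ≤ a) (haT : a ≤ T) :
    ∫ s in (0 : ℝ)..T, (v + c * min s a) = v * T + c * (a * T - a ^ 2 / 2) := by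
  have hc : Continuous fun s : ℝ ↦ v + c * min s a := by fun_prop
  have h₁ : ∫ s in (0 : ℝ)..a, (v + c * min s a) = ∫ s in (0 : ℝ)..a, (v + c * s) := by
    refine intervalIntegral.integral_congr fun s hs ↦ ?_
    rw [Set.uIcc_of_le ha] at hs
    simp [hs.2]
  have h₂ : ∫ s in a..T, (v + c * min s a) = ∫ _ in a..T, (v + c * a) := by
    refine intervalIntegral.integral_congr fun s hs ↦ ?_
    rw [Set.uIcc_of_le haT] at hs
    simp [hs.1]
  rw [← intervalIntegral.integral_add_adjacent_intervals (hc.intervalIntegrable 0 a)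
    (hc.intervalIntegrable a T), h₁, h₂, integral_affine, intervalIntegral.integral_const,
    smul_eq_mul]
  ring

/-- Distance bound for a speed that is dominated by a continuous profile. -/
theorem integral_speed_le {u f : ℝ → ℝ} {v m M T : ℝ} (hT : 0 ≤ T) (hu : Measurable u)
    (hb : ∀ t ∈ Set.Icc 0 T, u t ∈ Set.Icc m M) (hf : Continuous f)
    (hle : ∀ t ∈ Set.Icc 0 T, v + ∫ s in (0 : ℝ)..t, u s ≤ f t) :
    ∫ s in (0 : ℝ)..T, (v + ∫ r in (0 : ℝ)..s, u r) ≤ ∫ s in (0 : ℝ)..T, f s := by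
  refine intervalIntegral.integral_mono_on hT (ContinuousOn.intervalIntegrable ?_)
    (hf.intervalIntegrable 0 T) hle
  refine continuousOn_const.add (intervalIntegral.continuousOn_primitive_interval ?_)
  rw [Set.uIcc_of_le hT, ← intervalIntegrable_iff_integrableOn_Icc_of_le hT]
  exact intervalIntegrable_of_measurable_of_mem_Icc hT hu hb

theorem integral_le_mul_of_mem_Icc {u : ℝ → ℝ} {m M t : ℝ} (ht : 0 ≤ t) (hu : Measurable u)
    (hb : ∀ s ∈ Set.Icc 0 t, u s ∈ Set.Icc m M) :
    ∫ s in (0 : ℝ)..t, u s ≤ M * t := by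
  refine (intervalIntegral.integral_mono_on ht
    (intervalIntegrable_of_measurable_of_mem_Icc ht hu hb)
    (intervalIntegrable_const (c := M)) fun s hs ↦ (hb s hs).2).trans ?_
  simp [mul_comm]

/-- `𝒯(d, v)` is the least time `T ≥ 0` for which some admissible measurable
control traverses the distance `d` starting at speed `v` while respecting the acceleration
bounds and the speed limit. -/
theorem Tc_is_minimum_traversal_time
    (um uM vM : ℝ) (hum : um < 0) (huM : 0 < uM) (hvM : 0 < vM)
    (d v : ℝ) (hd : 0 ≤ d) (hv : v ∈ Set.Icc 0 vM) :
    IsLeast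
      {T : ℝ | 0 ≤ T ∧
        ∃ u : ℝ → ℝ, Measurable u ∧
          (∀ t ∈ Set.Icc (0 : ℝ) T, u t ∈ Set.Icc um uM) ∧
          (∀ t ∈ Set.Icc (0 : ℝ) T, (v + ∫ s in (0 : ℝ)..t, u s) ∈ Set.Icc 0 vM) ∧
          (-d + ∫ s in (0 : ℝ)..T, (v + ∫ r in (0 : ℝ)..s, u r)) = 0}
      (Tc uM vM d v) := by
  obtain ⟨hv0, hvM'⟩ := hv
  have ha : 0 ≤ (vM - v) / uM := div_nonneg (by linarith) huM.le
  have hca : uM * ((vM - v) / uM) = vM - v := by field_simp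
  set a := (vM - v) / uM with hadef
  constructor
  · by_cases h : 2 * uM * d ≤ vM ^ 2 - v ^ 2
    · rw [Tc, if_pos h]
      have hr := Real.sq_sqrt (show 0 ≤ 2 * uM * d + v ^ 2 by positivity)
      have hr0 := Real.sqrt_nonneg (2 * uM * d + v ^ 2)
      set r := √(2 * uM * d + v ^ 2)
      have hvr : v ≤ r := by
        have := mul_nonneg huM.le hd
        exact abs_le_of_sq_le_sq' (by nlinarith) hr0 |>.2
      have hrM : r ≤ vM := abs_le_of_sq_le_sq' (by nlinarith) hvM.le |>.2
      have hT : uM * ((r - v) / uM) = r - v := by field_simp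
      refine ⟨div_nonneg (by linarith) huM.le, fun _ ↦ uM, measurable_const,
        fun _ _ ↦ ⟨by linarith, le_rfl⟩, fun t ht ↦ ?_, ?_⟩
      · have h₁ := mul_nonneg huM.le ht.1
        have h₂ := mul_le_mul_of_nonneg_left ht.2 huM.le
        rw [hT] at h₂
        simp only [intervalIntegral.integral_const, smul_eq_mul, sub_zero]
        constructor <;> linarith
      · simp only [intervalIntegral.integral_const, smul_eq_mul, sub_zero]
        simp only [mul_comm _ uM]
        rw [integral_affine]
        field_simp
        nlinarith
    · have hTa : Tc uM vM d v = a + (2 * uM * d - vM ^ 2 + v ^ 2) / (2 * uM * vM) := by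
        rw [Tc, if_neg h]
      have haT : a ≤ Tc uM vM d v := by
        rw [hTa, le_add_iff_nonneg_right]
        exact div_nonneg (by linarith) (by positivity)
      refine ⟨ha.trans haT, fun s ↦ if s ≤ a then uM else 0,
        Measurable.ite measurableSet_Iic measurable_const measurable_const,
        fun t _ ↦ ?_, fun t ht ↦ ?_, ?_⟩
      · dsimp only
        split_ifs <;> constructor <;> linarith
      · rw [integral_bangCoast uM ha ht.1]
        have h₁ := mul_nonneg huM.le (le_min ht.1 ha)
        have h₂ := mul_le_mul_of_nonneg_left (min_le_right t a) huM.le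
        constructor <;> linarith
      · have hw : Set.EqOn (fun s ↦ v + ∫ r in (0 : ℝ)..s, (if r ≤ a then uM else 0))
            (fun s ↦ v + uM * min s a) (Set.uIcc 0 (Tc uM vM d v)) := by
          intro s hs
          rw [Set.uIcc_of_le (ha.trans haT)] at hs
          simp only [integral_bangCoast uM ha hs.1]
        rw [intervalIntegral.integral_congr hw, integral_affine_min v uM ha haT, hTa, hadef]
        field_simp
        ring
  · rintro T ⟨hT, u, hu, hb, hw, hx⟩
    have haff : ∀ t ∈ Set.Icc 0 T, v + ∫ s in (0 : ℝ)..t, u s ≤ v + uM * t := fun t ht ↦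
      add_le_add_right (integral_le_mul_of_mem_Icc ht.1 hu
        fun s hs ↦ hb s ⟨hs.1, hs.2.trans ht.2⟩) v
    have hd₁ : d ≤ v * T + uM * T ^ 2 / 2 := by
      have := integral_speed_le hT hu hb (by fun_prop) haff
      rw [integral_affine] at this
      linarith
    by_cases h : 2 * uM * d ≤ vM ^ 2 - v ^ 2
    · rw [Tc, if_pos h, div_le_iff₀ huM, sub_le_iff_le_add]
      exact Real.sqrt_le_iff.2 ⟨by positivity, by nlinarith⟩
    · rw [Tc, if_neg h, ← hadef]
      push Not at h
      have haT : a ≤ T := by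
        by_contra! hlt
        have h₁ : v + uM * T ≤ vM := by nlinarith
        have h₂ : (v + uM * T) ^ 2 ≤ vM ^ 2 :=
          pow_le_pow_left₀ (by positivity) h₁ 2
        nlinarith
      have hd₂ : d ≤ v * T + uM * (a * T - a ^ 2 / 2) := by
        have hmin : ∀ t ∈ Set.Icc 0 T, v + ∫ s in (0 : ℝ)..t, u s ≤ v + uM * min t a := by
          intro t ht
          rcases le_total t a with hta | hta
          · simpa [hta] using haff t ht
          · simpa [hta, hca] using (hw t ht).2
        have := integral_speed_le hT hu hb (by fun_prop) hmin
        rw [integral_affine_min v uM ha haT] at this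
        linarith
      have hd₃ : d ≤ vM * T - (vM - v) ^ 2 / (2 * uM) := by
        refine hd₂.trans_eq ?_
        rw [hadef]
        field_simp
        ring
      have hkey : a + (2 * uM * d - vM ^ 2 + v ^ 2) / (2 * uM * vM)
          = (d + (vM - v) ^ 2 / (2 * uM)) / vM := by
        rw [hadef]
        field_simp
        ring
      rw [hkey, div_le_iff₀ hvM]
      linarith
end

section
/- Suppose 0 ≤ v₁ ≤ v₂ with v₂ > 0, σ ∈ [1, σ₀], and u ∈ [u_m, u_M]. Then g_us(v₁, v₂, σ, u) ∈ [u_m, u_M]; that is, the unsaturated safe-following control respects the acceleration bounds on the coupling set. -/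
/-- Unsaturated safe-following control (for `v₂ > 0`, `σ ≠ 0`). -/
noncomputable def gus (um v₁ v₂ σ u : ℝ) : ℝ :=
  (v₁ / v₂ * (1 + σ * u / (-um)) - 1) * (-um / σ)

/-- The unsaturated control is a convex combination of `u` and `um / σ`. -/
theorem gus_eq_convex_combination {um σ : ℝ} (hum : um ≠ 0) (hσ : σ ≠ 0) (v₁ v₂ u : ℝ) :
    gus um v₁ v₂ σ u = v₁ / v₂ * u + (1 - v₁ / v₂) * (um / σ) := by
  unfold gus
  generalize v₁ / v₂ = r
  field_simp
  ring

/-- on the coupling set, the unsaturated safe-following control respects the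
acceleration bounds. -/
theorem gus_respects_acceleration_bounds
    (um uM σ₀ : ℝ) (hum : um < 0) (huM : 0 < uM) (hσ₀ : 1 < σ₀)
    (v₁ v₂ σ u : ℝ) (hv₁ : 0 ≤ v₁) (hv₁₂ : v₁ ≤ v₂) (hv₂ : 0 < v₂)
    (hσ : σ ∈ Set.Icc 1 σ₀) (hu : u ∈ Set.Icc um uM) :
    gus um v₁ v₂ σ u ∈ Set.Icc um uM := by
  have hσ_pos : 0 < σ := zero_lt_one.trans_le hσ.1
  have hr : v₁ / v₂ ≤ 1 := (div_le_one hv₂).2 hv₁₂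
  have hmem : um / σ ∈ Set.Icc um uM := by
    constructor
    · rw [le_div_iff₀ hσ_pos]
      nlinarith [hσ.1]
    · exact (div_neg_of_neg_of_pos hum hσ_pos).le.trans huM.le
  rw [gus_eq_convex_combination hum.ne hσ_pos.ne']
  exact convex_Icc um uM hu hmem (div_nonneg hv₁ hv₂.le) (sub_nonneg.2 hr)
    (add_sub_cancel _ _)
end

section
/- Fix a time t, let x₁, x₂, v₁, v₂ : ℝ → ℝ, and let u₁ ∈ [u_m, u_M]. Suppose: x₁ and x₂ are differentiable at t with x₁'(t) = v₁(t) and x₂'(t) = v₂(t); v₁ and v₂ are differentiable at t with v₁'(t) = u₁ and v₂'(t) = g_us(v₁(t), v₂(t), σ(t), u₁); v₂(s) ≥ v₁(s) ≥ 0 for all s in some neighborhood of t; v₂(t) > 0; and σ(t) > 0. Then the safety ratio σ is differentiable at t and σ'(t) = 0; that is, the unsaturated safe-following control keeps the safety ratio constant. -/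
theorem Dsafe_pos {um L : ℝ} (hL : 0 < L) (a b : ℝ) : 0 < Dsafe um L a b :=
  add_pos_of_pos_of_nonneg hL (le_max_left _ _)

theorem Dsafe_of_le {um L a b : ℝ} (hum : um < 0) (ha : 0 ≤ a) (hab : a ≤ b) :
    Dsafe um L a b = L + (b ^ 2 - a ^ 2) / (-2 * um) := by
  have h : 0 ≤ (b ^ 2 - a ^ 2) / (-2 * um) :=
    div_nonneg (sub_nonneg.2 (pow_le_pow_left₀ ha hab 2)) (by linarith)
  rw [Dsafe, max_eq_right h]

theorem hasDerivAt_Dsafe {um L t a b : ℝ} {v₁ v₂ : ℝ → ℝ} (hum : um < 0)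
    (hv₁ : HasDerivAt v₁ a t) (hv₂ : HasDerivAt v₂ b t)
    (h : ∀ᶠ s in nhds t, 0 ≤ v₁ s ∧ v₁ s ≤ v₂ s) :
    HasDerivAt (fun s => Dsafe um L (v₁ s) (v₂ s)) ((v₂ t * b - v₁ t * a) / (-um)) t := by
  have hd : HasDerivAt (fun s => L + (v₂ s ^ 2 - v₁ s ^ 2) / (-2 * um))
      ((v₂ t * b - v₁ t * a) / (-um)) t := by
    refine ((((hv₂.fun_pow 2).sub (hv₁.fun_pow 2)).div_const (-2 * um)).const_add L).congr_deriv ?_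
    have := hum.ne
    field_simp
    norm_num
    ring
  refine hd.congr_of_eventuallyEq ?_
  filter_upwards [h] with s hs
  exact Dsafe_of_le hum hs.1 hs.2

/-- The unsaturated control makes the safe-following distance grow at rate `(v₁ - v₂) / σ`. -/
theorem gus_distance_rate {um a b σ u : ℝ} (hum : um ≠ 0) (hb : b ≠ 0) (hσ : σ ≠ 0) :
    (b * gus um a b σ u - a * u) / (-um) = (a - b) / σ := by
  unfold gus
  field_simp
  ring

/-- the unsaturated safe-following control keeps the safety ratio
`σ(t) = (x₁(t) − x₂(t))/D(v₁(t), v₂(t))` constant: `σ'(t) = 0`. -/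
theorem gus_keeps_safety_ratio_constant
    (um uM L : ℝ) (hum : um < 0) (huM : 0 < uM) (hL : 0 < L)
    (t : ℝ) (x₁ x₂ v₁ v₂ : ℝ → ℝ) (u₁ : ℝ) (hu₁ : u₁ ∈ Set.Icc um uM)
    (hx₁ : HasDerivAt x₁ (v₁ t) t) (hx₂ : HasDerivAt x₂ (v₂ t) t)
    (hv₁ : HasDerivAt v₁ u₁ t)
    (hv₂ : HasDerivAt v₂
      (gus um (v₁ t) (v₂ t)
        ((x₁ t - x₂ t) / Dsafe um L (v₁ t) (v₂ t)) u₁) t)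
    (hnbhd : ∀ᶠ s in nhds t, 0 ≤ v₁ s ∧ v₁ s ≤ v₂ s)
    (hv₂pos : 0 < v₂ t)
    (hσpos : 0 < (x₁ t - x₂ t) / Dsafe um L (v₁ t) (v₂ t)) :
    HasDerivAt (fun s => (x₁ s - x₂ s) / Dsafe um L (v₁ s) (v₂ s)) 0 t := by
  have hD := Dsafe_pos (um := um) hL (v₁ t) (v₂ t)
  have hd := hasDerivAt_Dsafe (L := L) hum hv₁ hv₂ hnbhd
  rw [gus_distance_rate hum.ne hv₂pos.ne' hσpos.ne'] at hd
  have hgap : x₁ t - x₂ t ≠ 0 := fun h => by simp [h] at hσpos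
  refine ((hx₁.sub hx₂).fun_div hd hD.ne').congr_deriv ?_
  simp only [Pi.sub_apply]
  field_simp
  ring
end

section
/- Suppose 0 ≤ v₁ ≤ v^M, σ ∈ [1, σ₀], u ∈ [u_m, u_M], and g_us(v₁, v^M, σ, u) ≥ 0. Then v₁ ≥ v̲, where v̲ = −u_m·v^M/(−u_m + σ₀·u_M). That is, when the follower travels at the speed limit v^M, the unsaturated safe-following control can be nonnegative only if the leader's speed is at least v̲. -/
/-- when the follower moves at the speed limit `v^M`, the unsaturated
safe-following control is nonnegative only if the leader's speed is at least
`v̲ = −u_m v^M/(−u_m + σ₀ u_M)`. -/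
theorem gus_nonneg_requires_leader_speed
    (um uM vM σ₀ : ℝ) (hum : um < 0) (huM : 0 < uM) (hvM : 0 < vM) (hσ₀ : 1 < σ₀)
    (v₁ σ u : ℝ) (hv₁ : 0 ≤ v₁) (hv₁M : v₁ ≤ vM)
    (hσ : σ ∈ Set.Icc 1 σ₀) (hu : u ∈ Set.Icc um uM)
    (hg : 0 ≤ gus um v₁ vM σ u) :
    -um * vM / (-um + σ₀ * uM) ≤ v₁ := by
  obtain ⟨hσ1, hσ2⟩ := hσ
  have hpos : 0 < -um := by linarith
  have hratio : 1 ≤ v₁ / vM * (1 + σ * u / (-um)) :=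
    sub_nonneg.mp (nonneg_of_mul_nonneg_left hg (div_pos hpos (by linarith)))
  have heq : v₁ / vM * (1 + σ * u / (-um)) = v₁ * (-um + σ * u) / (-um * vM) := by
    have hum_ne := hum.ne
    field_simp
    ring
  rw [heq, one_le_div (by positivity)] at hratio
  have hσu : σ * u ≤ σ₀ * uM :=
    (mul_le_mul_of_nonneg_left hu.2 (by linarith)).trans
      (mul_le_mul_of_nonneg_right hσ2 huM.le)
  rw [div_le_iff₀ (by positivity)]
  exact hratio.trans (mul_le_mul_of_nonneg_left (by linarith) hv₁)
end

section
/- Under the closed-loop safe-following dynamics, for all t ≥ 0 one has v₂(t) ≥ v₁(t) and σ(t) = σ(0); in particular the safety constraint σ(t) ≥ 1 holds for all t ≥ 0. -/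
/-- Safety ratio. -/
noncomputable def ratio (um L : ℝ) (x₁ x₂ v₁ v₂ : ℝ → ℝ) (t : ℝ) : ℝ :=
  (x₁ t - x₂ t) / Dsafe um L (v₁ t) (v₂ t)

/-- A function that starts nonnegative and has positive derivative wherever it is negative
stays nonnegative. -/
theorem nonneg_of_deriv_pos_of_neg {w w' : ℝ → ℝ} {b : ℝ}
    (hw : ∀ t ∈ Set.Icc 0 b, HasDerivAt w (w' t) t) (h0 : 0 ≤ w 0)
    (hpos : ∀ t ∈ Set.Icc 0 b, w t < 0 → 0 < w' t) :
    ∀ t ∈ Set.Icc 0 b, 0 ≤ w t := by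
  intro t ht
  refine le_of_forall_pos_le_add fun ε hε => ?_
  have key := image_le_of_deriv_right_lt_deriv_boundary (f := fun t => -w t)
    (f' := fun t => -w' t) (a := 0) (b := b) (B := fun _ => ε) (B' := fun _ => 0)
    (fun s hs => (hw s hs).neg.continuousAt.continuousWithinAt)
    (fun s hs => (hw s (Set.Ico_subset_Icc_self hs)).neg.hasDerivWithinAt)
    (by linarith) (fun s => hasDerivAt_const s ε)
    (fun s hs hsε => by
      have := hpos s (Set.Ico_subset_Icc_self hs) (by linarith)
      linarith) ht
  linarith

/-- A solution of `E' = -c E` with `0 ≤ c` that starts at zero vanishes identically. -/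
theorem eq_zero_of_hasDerivAt_neg_mul_self {E c : ℝ → ℝ} {b : ℝ}
    (hE : ∀ t ∈ Set.Icc 0 b, HasDerivAt E (-c t * E t) t)
    (hc : ∀ t ∈ Set.Icc 0 b, 0 ≤ c t) (h0 : E 0 = 0) :
    ∀ t ∈ Set.Icc 0 b, E t = 0 := by
  have hd : ∀ t ∈ Set.Icc 0 b,
      HasDerivAt (fun s => E s ^ 2) (2 * E t * (-c t * E t)) t := fun t ht => by
    refine ((hE t ht).pow 2).congr_deriv ?_
    simp
  have hanti : AntitoneOn (fun s => E s ^ 2) (Set.Icc 0 b) := by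
    refine antitoneOn_of_deriv_nonpos (convex_Icc 0 b)
      (fun s hs => (hd s hs).continuousAt.continuousWithinAt)
      (fun s hs => (hd s (interior_subset hs)).differentiableAt.differentiableWithinAt)
      fun s hs => ?_
    rw [(hd s (interior_subset hs)).deriv]
    nlinarith [mul_nonneg (hc s (interior_subset hs)) (sq_nonneg (E s))]
  intro t ht
  have h := hanti (Set.left_mem_Icc.2 (ht.1.trans ht.2)) ht ht.1
  simp only [h0] at h
  nlinarith [sq_nonneg (E t)]

/-- A function that is continuous on `[0, ∞)`, starts positive, and is at least `L > 0` at the end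
of every interval on which it is positive, is positive on `[0, ∞)`. -/
theorem pos_of_forall_pos_imp_le {h : ℝ → ℝ} {L : ℝ} (hL : 0 < L)
    (hcont : ContinuousOn h (Set.Ici 0)) (h0 : 0 < h 0)
    (hstep : ∀ b, 0 ≤ b → (∀ t ∈ Set.Icc 0 b, 0 < h t) → L ≤ h b) :
    ∀ t, 0 ≤ t → 0 < h t := by
  by_contra! hneg
  obtain ⟨t, ht, hht⟩ := hneg
  have hcomp : IsCompact (Set.Icc 0 t ∩ h ⁻¹' Set.Iic 0) :=
    isCompact_Icc.of_isClosed_subset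
      ((hcont.mono Set.Icc_subset_Ici_self).preimage_isClosed_of_isClosed isClosed_Icc isClosed_Iic)
      Set.inter_subset_left
  obtain ⟨T, ⟨⟨hT0, hTt⟩, hhT⟩, hmin⟩ := hcomp.exists_isLeast ⟨t, ⟨ht, le_rfl⟩, hht⟩
  have hbefore : ∀ s ∈ Set.Ico 0 T, 0 < h s := fun s hs => by
    by_contra! hs'
    exact hs.2.not_ge (hmin ⟨⟨hs.1, hs.2.le.trans hTt⟩, hs'⟩)
  have hle : ∀ s ∈ Set.Ico 0 T, L ≤ h s := fun s hs =>
    hstep s hs.1 fun r hr => hbefore r ⟨hr.1, hr.2.trans_lt hs.2⟩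
  have hTpos : 0 < T := by
    rcases hT0.eq_or_lt with rfl | h'
    · exact absurd hhT (not_le.2 h0)
    · exact h'
  have hclos : T ∈ closure (Set.Ico 0 T) := by
    rw [closure_Ico hTpos.ne]
    exact Set.right_mem_Icc.2 hT0
  have hLT : L ≤ h T := by
    refine ContinuousWithinAt.closure_le hclos continuousWithinAt_const
      ((hcont T hT0).mono fun s hs => hs.1) hle
  exact (hL.trans_le hLT).not_ge hhT

theorem Dsafe_ge {um L v₁ v₂ : ℝ} : L ≤ Dsafe um L v₁ v₂ :=
  le_add_of_nonneg_right (le_max_left _ _)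

theorem Dsafe_eq_of_sq_le {um L v₁ v₂ : ℝ} (hum : um < 0) (h : 0 ≤ v₂ ^ 2 - v₁ ^ 2) :
    Dsafe um L v₁ v₂ = L + (v₂ ^ 2 - v₁ ^ 2) / (-2 * um) := by
  rw [Dsafe, max_eq_right (div_nonneg h (by linarith))]

/-- under the closed-loop safe-following dynamics, for all t ≥ 0 one has v₂(t) ≥ v₁(t) and σ(t) = σ(0); in particular σ(t) ≥ 1. -/
theorem closed_loop_safety
    (um uM L σ₀ V : ℝ) (hum : um < 0) (huM : 0 < uM) (hL : 0 < L)
    (hσ₀ : 1 < σ₀) (hV : 0 ≤ V)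
    (x₁ x₂ v₁ v₂ u₁ : ℝ → ℝ)
    (hx₁ : ∀ t : ℝ, 0 ≤ t → HasDerivAt x₁ (v₁ t) t)
    (hx₂ : ∀ t : ℝ, 0 ≤ t → HasDerivAt x₂ (v₂ t) t)
    (hv₁ : ∀ t : ℝ, 0 ≤ t → HasDerivAt v₁ (u₁ t) t)
    (hu₁ : ∀ t : ℝ, 0 ≤ t → u₁ t ∈ Set.Icc um uM)
    (hv₁bnd : ∀ t : ℝ, 0 ≤ t → v₁ t ∈ Set.Icc 0 V)
    (hv₂pos : ∀ t : ℝ, 0 ≤ t → 0 < v₂ t)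
    (hv₂ : ∀ t : ℝ, 0 ≤ t →
      HasDerivAt v₂ (gus um (v₁ t) (v₂ t) (ratio um L x₁ x₂ v₁ v₂ t) (u₁ t)) t)
    (hinit : v₁ 0 ≤ v₂ 0)
    (hσinit : ratio um L x₁ x₂ v₁ v₂ 0 ∈ Set.Icc 1 σ₀) :
    ∀ t : ℝ, 0 ≤ t → v₁ t ≤ v₂ t ∧ ratio um L x₁ x₂ v₁ v₂ t = ratio um L x₁ x₂ v₁ v₂ 0 ∧ 1 ≤ ratio um L x₁ x₂ v₁ v₂ t := by
  set h : ℝ → ℝ := fun t => x₁ t - x₂ t with hh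
  set w : ℝ → ℝ := fun t => v₂ t ^ 2 - v₁ t ^ 2 with hw
  set s := ratio um L x₁ x₂ v₁ v₂ 0 with hs
  have hDpos : ∀ t, 0 < Dsafe um L (v₁ t) (v₂ t) := fun t => hL.trans_le Dsafe_ge
  have hs1 : 1 ≤ s := hσinit.1
  have hdh : ∀ t, 0 ≤ t → HasDerivAt h (v₁ t - v₂ t) t := fun t ht => (hx₁ t ht).sub (hx₂ t ht)
  have hh0 : h 0 = s * Dsafe um L (v₁ 0) (v₂ 0) := (div_mul_cancel₀ _ (hDpos 0).ne').symm
  have hw0 : 0 ≤ w 0 := sub_nonneg.2 (pow_le_pow_left₀ (hv₁bnd 0 le_rfl).1 hinit 2)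
  have hdw : ∀ t, 0 ≤ t → 0 < h t → HasDerivAt w
      (2 * um * (v₂ t - v₁ t) * Dsafe um L (v₁ t) (v₂ t) / h t) t := fun t ht hht => by
    refine (((hv₂ t ht).pow 2).sub ((hv₁ t ht).pow 2)).congr_deriv ?_
    have h1 := (hv₂pos t ht).ne'
    have h2 := (hDpos t).ne'
    have h3 : x₁ t - x₂ t ≠ 0 := hht.ne'
    have h4 := hum.ne
    simp only [gus, ratio, hh]
    field_simp
    ring
  have hlocal : ∀ b, 0 ≤ b → (∀ t ∈ Set.Icc 0 b, 0 < h t) →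
      0 ≤ w b ∧ h b = s * Dsafe um L (v₁ b) (v₂ b) := by
    intro b hb hpos
    have hwnn : ∀ t ∈ Set.Icc 0 b, 0 ≤ w t := by
      refine nonneg_of_deriv_pos_of_neg (fun t ht => hdw t ht.1 (hpos t ht)) hw0
        fun t ht hneg => ?_
      have hlt : v₂ t < v₁ t :=
        lt_of_pow_lt_pow_left₀ 2 (hv₁bnd t ht.1).1 (sub_neg.1 hneg)
      refine div_pos (mul_pos ?_ (hDpos t)) (hpos t ht)
      nlinarith
    have hle : ∀ t ∈ Set.Icc 0 b, v₁ t ≤ v₂ t := fun t ht =>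
      le_of_sq_le_sq (sub_nonneg.1 (hwnn t ht)) (hv₂pos t ht.1).le
    have hE := eq_zero_of_hasDerivAt_neg_mul_self
      (E := fun t => h t - s * (L + w t / (-2 * um))) (c := fun t => (v₂ t - v₁ t) / h t) (b := b)
      (fun t ht => by
        refine ((hdh t ht.1).sub
          ((((hdw t ht.1 (hpos t ht)).div_const (-2 * um)).const_add L).const_mul s)).congr_deriv ?_
        have h3 := (hpos t ht).ne'
        have h4 := hum.ne
        rw [Dsafe_eq_of_sq_le hum (hwnn t ht)]
        simp only [hw]
        field_simp
        ring)
      (fun t ht => div_nonneg (sub_nonneg.2 (hle t ht)) (hpos t ht).le)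
      (by rw [hh0, Dsafe_eq_of_sq_le hum hw0, sub_self])
      b ⟨hb, le_rfl⟩
    have hwb := hwnn b ⟨hb, le_rfl⟩
    refine ⟨hwb, ?_⟩
    rw [Dsafe_eq_of_sq_le hum hwb]
    exact sub_eq_zero.1 hE
  have hpos : ∀ t, 0 ≤ t → 0 < h t := by
    refine pos_of_forall_pos_imp_le hL
      (fun t ht => (hdh t ht).continuousAt.continuousWithinAt)
      (hh0 ▸ mul_pos (by linarith) (hDpos 0)) fun b hb hb' => ?_
    rw [(hlocal b hb hb').2]
    exact Dsafe_ge.trans (le_mul_of_one_le_left (hDpos b).le hs1)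
  intro t ht
  obtain ⟨hwt, hht⟩ := hlocal t ht fun r hr => hpos r hr.1
  have hst : ratio um L x₁ x₂ v₁ v₂ t = s := (div_eq_iff (hDpos t).ne').2 hht
  exact ⟨le_of_sq_le_sq (sub_nonneg.1 hwt) (hv₂pos t ht).le, hst, hst ▸ hs1⟩
end

section
/- Under the closed-loop safe-following dynamics, the inter-vehicle distance converges: x₁(t) − x₂(t) → σ(0)·L as t → ∞, and σ(0)·L ≤ σ₀·L. -/
/-- A function that starts nonnegative and does not decrease where it is negative stays
nonnegative. -/
theorem nonneg_of_deriv_nonneg_where_neg {f f' : ℝ → ℝ} {a b : ℝ} (hab : a ≤ b)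
    (hf : ∀ t ∈ Set.Icc a b, HasDerivAt f (f' t) t) (ha : 0 ≤ f a)
    (hf' : ∀ t ∈ Set.Icc a b, f t < 0 → 0 ≤ f' t) : 0 ≤ f b := by
  by_contra! hb
  have hcont : ContinuousOn f (Set.Icc a b) := fun t ht =>
    (hf t ht).continuousAt.continuousWithinAt
  have hclosed : IsClosed (Set.Icc a b ∩ f ⁻¹' Set.Ici 0) :=
    hcont.preimage_isClosed_of_isClosed isClosed_Icc isClosed_Ici
  have hcompact : IsCompact (Set.Icc a b ∩ f ⁻¹' Set.Ici 0) :=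
    isCompact_Icc.of_isClosed_subset hclosed Set.inter_subset_left
  obtain ⟨c, ⟨hc, hfc⟩, hmax⟩ := hcompact.exists_isGreatest ⟨a, ⟨le_rfl, hab⟩, ha⟩
  have hfc : 0 ≤ f c := hfc
  have hsub : ∀ t ∈ Set.Icc c b, t ∈ Set.Icc a b := fun t ht => ⟨hc.1.trans ht.1, ht.2⟩
  have hmono : MonotoneOn f (Set.Icc c b) := by
    refine monotoneOn_of_hasDerivWithinAt_nonneg (f' := f') (convex_Icc c b)
      (hcont.mono hsub) (fun t ht => ?_) (fun t ht => ?_)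
    · exact (hf t (hsub t (interior_subset ht))).hasDerivWithinAt
    · have hta := hsub t (interior_subset ht)
      rw [interior_Icc] at ht
      refine hf' t hta ?_
      by_contra! h
      exact absurd (hmax ⟨hta, h⟩) (not_le.2 ht.1)
  exact absurd (hmono ⟨le_rfl, hc.2⟩ ⟨hc.2, le_rfl⟩ hc.2) (not_le.2 (hb.trans_le hfc))

section GapDynamics

variable {b L : ℝ} {h w d : ℝ → ℝ}

/-- As long as the gap `h` is positive, the kinetic excess `w` stays nonnegative and `h` stays
proportional to `L + w / b`. -/
theorem gap_invariant_of_pos {T : ℝ} (hb : 0 < b) (hL : 0 < L) (hT : 0 ≤ T)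
    (hh : ∀ t ∈ Set.Icc 0 T, HasDerivAt h (-d t) t)
    (hw : ∀ t ∈ Set.Icc 0 T, HasDerivAt w (-(b / (h t / (L + max 0 (w t / b)))) * d t) t)
    (hd : ∀ t ∈ Set.Icc 0 T, w t < 0 → d t ≤ 0) (hw0 : 0 ≤ w 0)
    (hpos : ∀ t ∈ Set.Icc 0 T, 0 < h t) :
    0 ≤ w T ∧ h T = h 0 / (L + w 0 / b) * (L + w T / b) := by
  have hw_nonneg : ∀ t ∈ Set.Icc 0 T, 0 ≤ w t := by
    intro t ht
    have hsub : ∀ s ∈ Set.Icc 0 t, s ∈ Set.Icc 0 T := fun s hs => ⟨hs.1, hs.2.trans ht.2⟩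
    refine nonneg_of_deriv_nonneg_where_neg ht.1 (fun s hs => hw s (hsub s hs)) hw0 ?_
    intro s hs hws
    have hdle := hd s (hsub s hs) hws
    have hhs := hpos s (hsub s hs)
    have : 0 < L + max 0 (w s / b) := by positivity
    exact mul_nonneg_of_nonpos_of_nonpos (neg_nonpos.2 (by positivity)) hdle
  have hDpos : ∀ t ∈ Set.Icc 0 T, 0 < L + w t / b := fun t ht => by
    have := hw_nonneg t ht
    positivity
  have hq : ∀ t ∈ Set.Icc 0 T, HasDerivAt (fun s => h s / (L + w s / b)) 0 t := by
    intro t ht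
    have hD := hDpos t ht
    have hht := hpos t ht
    have hmax : max 0 (w t / b) = w t / b := max_eq_right (by have := hw_nonneg t ht; positivity)
    have hder := (hh t ht).div (((hw t ht).div_const b).const_add L) hD.ne'
    rw [hmax] at hder
    refine hder.congr_deriv ?_
    rw [div_eq_zero_iff]
    left
    field_simp
    ring
  have hconst := constant_of_has_deriv_right_zero
    (fun t ht => (hq t ht).continuousAt.continuousWithinAt)
    (fun t ht => (hq t (Set.Ico_subset_Icc_self ht)).hasDerivWithinAt) T ⟨hT, le_rfl⟩
  refine ⟨hw_nonneg T ⟨hT, le_rfl⟩, ?_⟩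
  rw [← hconst, div_mul_cancel₀ _ (hDpos T ⟨hT, le_rfl⟩).ne']

/-- A gap that is initially positive stays positive. -/
theorem gap_pos (hb : 0 < b) (hL : 0 < L)
    (hh : ∀ t, 0 ≤ t → HasDerivAt h (-d t) t)
    (hw : ∀ t, 0 ≤ t → 0 < h t → HasDerivAt w (-(b / (h t / (L + max 0 (w t / b)))) * d t) t)
    (hd : ∀ t, 0 ≤ t → w t < 0 → d t ≤ 0) (hw0 : 0 ≤ w 0) (hh0 : 0 < h 0)
    {t : ℝ} (ht : 0 ≤ t) : 0 < h t := by
  by_contra! hneg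
  have hcont : ContinuousOn h (Set.Icc 0 t) := fun s hs =>
    (hh s hs.1).continuousAt.continuousWithinAt
  have hclosed : IsClosed (Set.Icc 0 t ∩ h ⁻¹' Set.Iic 0) :=
    hcont.preimage_isClosed_of_isClosed isClosed_Icc isClosed_Iic
  have hcompact : IsCompact (Set.Icc 0 t ∩ h ⁻¹' Set.Iic 0) :=
    isCompact_Icc.of_isClosed_subset hclosed Set.inter_subset_left
  obtain ⟨c, ⟨hc, hhc⟩, hmin⟩ := hcompact.exists_isLeast ⟨t, ⟨ht, le_rfl⟩, hneg⟩
  have hhc : h c ≤ 0 := hhc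
  have hc0 : 0 < c := hc.1.lt_of_ne (by rintro rfl; exact absurd hhc (not_le.2 hh0))
  have hpos : ∀ s, 0 ≤ s → s < c → 0 < h s := by
    intro s hs hsc
    by_contra! hle
    exact absurd (hmin ⟨⟨hs, hsc.le.trans hc.2⟩, hle⟩) (not_le.2 hsc)
  have hbound : ∀ s, 0 < s → s < c → h 0 / (L + w 0 / b) * L ≤ h s := by
    intro s hs hsc
    obtain ⟨hws, hhs⟩ := gap_invariant_of_pos hb hL hs.le (fun r hr => hh r hr.1)
      (fun r hr => hw r hr.1 (hpos r hr.1 (hr.2.trans_lt hsc))) (fun r hr => hd r hr.1) hw0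
      (fun r hr => hpos r hr.1 (hr.2.trans_lt hsc))
    rw [hhs]
    gcongr
    exact le_add_of_nonneg_right (by positivity)
  have hlim : h 0 / (L + w 0 / b) * L ≤ h c := by
    refine ge_of_tendsto ((hh c hc0.le).continuousAt.mono_left
      (nhdsWithin_le_nhds (s := Set.Iio c))) ?_
    filter_upwards [Ioo_mem_nhdsLT hc0] with s hs using hbound s hs.1 hs.2
  have : 0 < h 0 / (L + w 0 / b) * L := by positivity
  linarith

end GapDynamics

/-- A nonnegative function whose derivative is at most `-k` times itself, `k > 0`, tends to `0`. -/
theorem tendsto_zero_of_deriv_le_neg_mul {f f' : ℝ → ℝ} {k : ℝ} (hk : 0 < k)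
    (hf : ∀ t, 0 ≤ t → HasDerivAt f (f' t) t) (hnonneg : ∀ t, 0 ≤ t → 0 ≤ f t)
    (hf' : ∀ t, 0 ≤ t → f' t ≤ -k * f t) : Filter.Tendsto f Filter.atTop (nhds 0) := by
  have hder : ∀ t, 0 ≤ t → HasDerivAt (fun s => f s * Real.exp (k * s))
      (f' t * Real.exp (k * t) + f t * (Real.exp (k * t) * k)) t := by
    intro t ht
    have hlin : HasDerivAt (fun s => k * s) k t := by
      simpa using (hasDerivAt_id t).const_mul k
    exact (hf t ht).mul hlin.exp
  have hanti : AntitoneOn (fun s => f s * Real.exp (k * s)) (Set.Ici 0) := by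
    refine antitoneOn_of_hasDerivWithinAt_nonpos (convex_Ici 0)
      (fun t ht => (hder t ht).continuousAt.continuousWithinAt)
      (fun t ht => (hder t (interior_subset (s := Set.Ici (0 : ℝ)) ht)).hasDerivWithinAt)
      (fun t ht => ?_)
    have := hf' t (interior_subset (s := Set.Ici (0 : ℝ)) ht)
    nlinarith [Real.exp_pos (k * t)]
  have hexp : Filter.Tendsto (fun t => f 0 * Real.exp (-(k * t))) Filter.atTop (nhds 0) := by
    simpa using (Real.tendsto_exp_neg_atTop_nhds_zero.comp
      (Filter.tendsto_id.const_mul_atTop hk)).const_mul (f 0)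
  refine tendsto_of_tendsto_of_tendsto_of_le_of_le' tendsto_const_nhds hexp ?_ ?_
  · filter_upwards [Filter.eventually_ge_atTop 0] with t ht using hnonneg t ht
  · filter_upwards [Filter.eventually_ge_atTop 0] with t ht
    have hle : f t * Real.exp (k * t) ≤ f 0 * Real.exp (k * 0) :=
      hanti Set.self_mem_Ici ht ht
    rw [mul_zero, Real.exp_zero, mul_one] at hle
    rwa [Real.exp_neg, ← div_eq_mul_inv, le_div_iff₀ (Real.exp_pos _)]


/-- under the closed-loop safe-following dynamics, the inter-vehicle distance converges to σ(0)·L, and σ(0)·L ≤ σ₀·L. -/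
theorem closed_loop_distance_convergence
    (um uM L σ₀ V : ℝ) (hum : um < 0) (huM : 0 < uM) (hL : 0 < L)
    (hσ₀ : 1 < σ₀) (hV : 0 ≤ V)
    (x₁ x₂ v₁ v₂ u₁ : ℝ → ℝ)
    (hx₁ : ∀ t : ℝ, 0 ≤ t → HasDerivAt x₁ (v₁ t) t)
    (hx₂ : ∀ t : ℝ, 0 ≤ t → HasDerivAt x₂ (v₂ t) t)
    (hv₁ : ∀ t : ℝ, 0 ≤ t → HasDerivAt v₁ (u₁ t) t)
    (hu₁ : ∀ t : ℝ, 0 ≤ t → u₁ t ∈ Set.Icc um uM)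
    (hv₁bnd : ∀ t : ℝ, 0 ≤ t → v₁ t ∈ Set.Icc 0 V)
    (hv₂pos : ∀ t : ℝ, 0 ≤ t → 0 < v₂ t)
    (hv₂ : ∀ t : ℝ, 0 ≤ t →
      HasDerivAt v₂ (gus um (v₁ t) (v₂ t) (ratio um L x₁ x₂ v₁ v₂ t) (u₁ t)) t)
    (hinit : v₁ 0 ≤ v₂ 0)
    (hσinit : ratio um L x₁ x₂ v₁ v₂ 0 ∈ Set.Icc 1 σ₀) :
    Filter.Tendsto (fun t => x₁ t - x₂ t) Filter.atTop (nhds (ratio um L x₁ x₂ v₁ v₂ 0 * L)) ∧ ratio um L x₁ x₂ v₁ v₂ 0 * L ≤ σ₀ * L := by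
  refine ⟨?_, mul_le_mul_of_nonneg_right hσinit.2 hL.le⟩
  set h : ℝ → ℝ := fun t => x₁ t - x₂ t with hdef
  set w : ℝ → ℝ := fun t => v₂ t ^ 2 - v₁ t ^ 2 with wdef
  set b : ℝ := -2 * um with bdef
  have hb : 0 < b := by linarith
  have hratio : ∀ t, ratio um L x₁ x₂ v₁ v₂ t = h t / (L + max 0 (w t / b)) := fun _ => rfl
  have hh : ∀ t, 0 ≤ t → HasDerivAt h (-(v₂ t - v₁ t)) t := fun t ht =>
    ((hx₁ t ht).sub (hx₂ t ht)).congr_deriv (by ring)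
  have hw : ∀ t, 0 ≤ t → 0 < h t →
      HasDerivAt w (-(b / (h t / (L + max 0 (w t / b)))) * (v₂ t - v₁ t)) t := by
    intro t ht hht
    have hv := hv₂pos t ht
    have hratio_ne : ratio um L x₁ x₂ v₁ v₂ t ≠ 0 := by
      rw [hratio]
      positivity
    refine (((hv₂ t ht).pow 2).sub ((hv₁ t ht).pow 2)).congr_deriv ?_
    rw [← hratio, bdef, gus]
    have hum_ne := hum.ne
    field_simp
    ring
  have hd : ∀ t, 0 ≤ t → w t < 0 → v₂ t - v₁ t ≤ 0 := by
    intro t ht hwt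
    have := (hv₁bnd t ht).1
    simp only [wdef] at hwt
    nlinarith [hv₂pos t ht]
  have hw0 : 0 ≤ w 0 := by
    have := (hv₁bnd 0 le_rfl).1
    simp only [wdef]
    nlinarith
  have hs : ratio um L x₁ x₂ v₁ v₂ 0 = h 0 / (L + w 0 / b) := by
    rw [hratio, max_eq_right (by positivity)]
  set s := ratio um L x₁ x₂ v₁ v₂ 0
  have hspos : 0 < s := one_pos.trans_le hσinit.1
  have hh0 : 0 < h 0 := by
    rw [eq_div_iff (by positivity)] at hs
    rw [← hs]
    positivity
  have hpos : ∀ t, 0 ≤ t → 0 < h t := fun t ht => gap_pos hb hL hh hw hd hw0 hh0 ht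
  have hinv : ∀ t, 0 ≤ t → 0 ≤ w t ∧ h t = s * (L + w t / b) := by
    intro t ht
    rw [hs]
    exact gap_invariant_of_pos hb hL ht (fun r hr => hh r hr.1)
      (fun r hr => hw r hr.1 (hpos r hr.1)) (fun r hr => hd r hr.1) hw0
      (fun r hr => hpos r hr.1)
  have hw' : ∀ t, 0 ≤ t → HasDerivAt w (-(b / s) * (v₂ t - v₁ t)) t := by
    intro t ht
    obtain ⟨hwt, hht⟩ := hinv t ht
    have hD : 0 < L + w t / b := by positivity
    refine (hw t ht (hpos t ht)).congr_deriv ?_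
    rw [max_eq_right (by positivity), hht, mul_div_cancel_right₀ _ hD.ne']
  have hle : ∀ t, 0 ≤ t → v₁ t ≤ v₂ t := by
    intro t ht
    have hwt := (hinv t ht).1
    simp only [wdef] at hwt
    exact abs_le_of_sq_le_sq' (by linarith) (hv₂pos t ht).le |>.2
  have hanti : AntitoneOn w (Set.Ici 0) := by
    refine antitoneOn_of_hasDerivWithinAt_nonpos (convex_Ici 0)
      (fun t ht => (hw' t ht).continuousAt.continuousWithinAt)
      (fun t ht => (hw' t (interior_subset (s := Set.Ici (0 : ℝ)) ht)).hasDerivWithinAt)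
      (fun t ht => ?_)
    have := hle t (interior_subset (s := Set.Ici (0 : ℝ)) ht)
    exact mul_nonpos_of_nonpos_of_nonneg (neg_nonpos.2 (by positivity)) (by linarith)
  set M : ℝ := V + (V ^ 2 + w 0 + 1)
  have hM : 0 < M := by positivity
  have hsum : ∀ t, 0 ≤ t → v₂ t + v₁ t ≤ M := by
    intro t ht
    have hwt : w t ≤ w 0 := hanti Set.self_mem_Ici ht ht
    have hwt' : w t = v₂ t ^ 2 - v₁ t ^ 2 := rfl
    obtain ⟨hv₁0, hv₁V⟩ := hv₁bnd t ht
    have hsq : v₁ t ^ 2 ≤ V ^ 2 := pow_le_pow_left₀ hv₁0 hv₁V 2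
    have hv₂sq : v₂ t ≤ v₂ t ^ 2 + 1 := by nlinarith [sq_nonneg (v₂ t - 1)]
    linarith
  have hwlim : Filter.Tendsto w Filter.atTop (nhds 0) := by
    refine tendsto_zero_of_deriv_le_neg_mul (k := b / s / M) (by positivity) hw'
      (fun t ht => (hinv t ht).1) (fun t ht => ?_)
    have hdt : 0 ≤ v₂ t - v₁ t := sub_nonneg.2 (hle t ht)
    have hwM : w t / M ≤ v₂ t - v₁ t := by
      rw [div_le_iff₀ hM]
      calc w t = (v₂ t - v₁ t) * (v₂ t + v₁ t) := by simp only [wdef]; ring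
        _ ≤ (v₂ t - v₁ t) * M := mul_le_mul_of_nonneg_left (hsum t ht) hdt
    calc -(b / s) * (v₂ t - v₁ t) ≤ -(b / s) * (w t / M) :=
          mul_le_mul_of_nonpos_left hwM (neg_nonpos.2 (by positivity))
      _ = -(b / s / M) * w t := by ring
  have hlim : Filter.Tendsto (fun t => s * (L + w t / b)) Filter.atTop (nhds (s * L)) := by
    simpa using ((hwlim.div_const b).const_add L).const_mul s
  refine hlim.congr' ?_
  filter_upwards [Filter.eventually_ge_atTop 0] with t ht using (hinv t ht).2.symm
end

section
/- Fix a time t, let v₁, v₂ : ℝ → ℝ, and let u₁, σ_t ∈ ℝ with v₂(t) > 0 and σ_t ≠ 0. Suppose v₁ and v₂ are differentiable at t with v₁'(t) = u₁ and v₂'(t) = g_us(v₁(t), v₂(t), σ_t, u₁). Then the velocity error e := v₂ − v₁ is differentiable at t and satisfies e'(t) = −((σ_t·u₁ − u_m)/(σ_t·v₂(t)))·(v₂(t) − v₁(t)). -/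
/-- under the unsaturated safe-following control, the velocity error
`e = v₂ − v₁` satisfies `e'(t) = −((σ u₁ − u_m)/(σ v₂(t)))·(v₂(t) − v₁(t))`. -/
theorem velocity_error_derivative
    (um : ℝ) (hum : um < 0)
    (t : ℝ) (v₁ v₂ : ℝ → ℝ) (u₁ σt : ℝ)
    (hv₂pos : 0 < v₂ t) (hσt : σt ≠ 0)
    (hv₁ : HasDerivAt v₁ u₁ t)
    (hv₂ : HasDerivAt v₂ (gus um (v₁ t) (v₂ t) σt u₁) t) :
    HasDerivAt (fun s => v₂ s - v₁ s)
      (-((σt * u₁ - um) / (σt * v₂ t)) * (v₂ t - v₁ t)) t := by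
  have hum' : um ≠ 0 := hum.ne
  have hv₂' : v₂ t ≠ 0 := hv₂pos.ne'
  refine (hv₂.sub hv₁).congr_deriv ?_
  unfold gus
  field_simp
  ring
end

section
/- For every fixed v ∈ [0, v^M], the function d ↦ ℒ(d, v) is non-increasing on [0, ∞); moreover, it is constant on the set of d ≥ 0 with 2·u_M·d ≥ (v^M)² − v². Consequently, over any constraint set of the form {d : d ≥ d₀} the maximum of d ↦ ℒ(d, v) is attained at d = d₀. -/
/-- `ℒ(d, v) = (d + σ₀ D(v, v^M))/v^M − 𝒯(d, v)`. -/
noncomputable def Lc (um uM vM L σ₀ d v : ℝ) : ℝ :=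
  (d + σ₀ * Dsafe um L v vM) / vM - Tc uM vM d v

/-- Closed form of `Lc` in terms of the shortfall between the speed limit and the speed
`√(2 u_M d + v²)` reached by accelerating maximally over the distance `d`. -/
lemma Lc_eq_sq_shortfall {um uM vM L σ₀ d v : ℝ} (huM : 0 < uM) (hvM : 0 < vM) (hd : 0 ≤ d) :
    Lc um uM vM L σ₀ d v = σ₀ * Dsafe um L v vM / vM +
      (max 0 (vM - √(2 * uM * d + v ^ 2)) ^ 2 - (vM - v) ^ 2) / (2 * uM * vM) := by
  have h0 : 0 ≤ 2 * uM * d + v ^ 2 := by positivity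
  unfold Lc Tc
  split_ifs with h
  · have hw : √(2 * uM * d + v ^ 2) ≤ vM :=
      Real.sqrt_le_iff.2 ⟨hvM.le, by linarith⟩
    have hsq := Real.sq_sqrt h0
    rw [max_eq_right (sub_nonneg.2 hw)]
    generalize √(2 * uM * d + v ^ 2) = w at hsq ⊢
    field_simp
    linear_combination -hsq
  · have hw : vM ≤ √(2 * uM * d + v ^ 2) := Real.le_sqrt_of_sq_le (by linarith)
    rw [max_eq_left (sub_nonpos.2 hw)]
    field_simp
    ring

/-- for fixed `v ∈ [0, v^M]`, `d ↦ ℒ(d, v)` is non-increasing on `[0, ∞)`,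
constant where `2 u_M d ≥ (v^M)² − v²`, and hence maximized at the left endpoint of any
constraint set `{d : d ≥ d₀}`. -/
theorem Lc_antitone_in_distance
    (um uM vM L σ₀ : ℝ) (hum : um < 0) (huM : 0 < uM) (hvM : 0 < vM)
    (hL : 0 < L) (hσ₀ : 1 < σ₀)
    (v : ℝ) (hv : v ∈ Set.Icc 0 vM) :
    AntitoneOn (fun d => Lc um uM vM L σ₀ d v) (Set.Ici 0) ∧
    (∀ d d' : ℝ, 0 ≤ d → 0 ≤ d' → vM ^ 2 - v ^ 2 ≤ 2 * uM * d →
      vM ^ 2 - v ^ 2 ≤ 2 * uM * d' → Lc um uM vM L σ₀ d v = Lc um uM vM L σ₀ d' v) ∧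
    (∀ d₀ : ℝ, 0 ≤ d₀ → ∀ d : ℝ, d₀ ≤ d → Lc um uM vM L σ₀ d v ≤ Lc um uM vM L σ₀ d₀ v) := by
  have hanti : AntitoneOn (fun d => Lc um uM vM L σ₀ d v) (Set.Ici 0) := by
    intro a ha b hb hab
    simp only [Lc_eq_sq_shortfall huM hvM ha, Lc_eq_sq_shortfall huM hvM hb]
    gcongr
  refine ⟨hanti, fun d d' hd hd' h h' => ?_, fun d₀ h₀ d hd => hanti h₀ (h₀.trans hd) hd⟩
  have hw : vM ≤ √(2 * uM * d + v ^ 2) := Real.le_sqrt_of_sq_le (by linarith)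
  have hw' : vM ≤ √(2 * uM * d' + v ^ 2) := Real.le_sqrt_of_sq_le (by linarith)
  rw [Lc_eq_sq_shortfall huM hvM hd, Lc_eq_sq_shortfall huM hvM hd',
    max_eq_left (sub_nonpos.2 hw), max_eq_left (sub_nonpos.2 hw')]
end

section
/- Suppose 0 ≤ v₁ < v₂, σ ≥ 1, u ∈ [u_m, u_M], and g_us(v₁, v₂, σ, u) > 0. Then u > 0 and g_us(v₁, v₂, σ, u) < u. That is, under the unsaturated safe-following control the follower can accelerate only if the leader accelerates, and in that case the velocity error v₂ − v₁ is strictly decreasing. -/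
/-- under the unsaturated safe-following control, the follower accelerates
only if the leader accelerates, and then the velocity error is strictly decreasing
(`g_us < u`). -/
theorem gus_pos_implies_leader_accelerates
    (um uM : ℝ) (hum : um < 0) (huM : 0 < uM)
    (v₁ v₂ σ u : ℝ) (hv₁ : 0 ≤ v₁) (hv₁₂ : v₁ < v₂) (hσ : 1 ≤ σ)
    (hu : u ∈ Set.Icc um uM) (hg : 0 < gus um v₁ v₂ σ u) :
    0 < u ∧ gus um v₁ v₂ σ u < u := by
  have ha : 0 < -um := neg_pos.mpr hum
  have hs : 0 < σ := by linarith
  have hr₀ : 0 ≤ v₁ / v₂ := div_nonneg hv₁ (by linarith)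
  have hr₁ : v₁ / v₂ < 1 := (div_lt_one (by linarith)).mpr hv₁₂
  have key : gus um v₁ v₂ σ u = (v₁ / v₂ * (-um + σ * u) - -um) / σ := by
    unfold gus
    generalize v₁ / v₂ = r
    generalize -um = a at ha
    field_simp
  rw [key] at hg ⊢
  have hnum : 0 < v₁ / v₂ * (-um + σ * u) - -um := (div_pos_iff_of_pos_right hs).mp hg
  have hsum : 0 < -um + σ * u := pos_of_mul_pos_right (by linarith) hr₀
  have hlt : v₁ / v₂ * (-um + σ * u) < -um + σ * u := mul_lt_of_lt_one_left hsum hr₁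
  refine ⟨pos_of_mul_pos_right (by linarith : 0 < σ * u) hs.le, ?_⟩
  rw [div_lt_iff₀ hs]
  linarith
end

section
/- Fix a time t and let x₁, x₂, v₁, v₂ : ℝ → ℝ. Suppose x₁ and x₂ are differentiable at t with x₁'(t) = v₁(t) and x₂'(t) = v₂(t), that v₁ and v₂ are continuous at t, and that v₁(t) > v₂(t) ≥ 0. Then the safety ratio σ is differentiable at t with σ'(t) = (v₁(t) − v₂(t))/L > 0; that is, when the leading vehicle is strictly faster than the following vehicle, the safety ratio is strictly increasing. -/
/-- when the leading vehicle is strictly faster than the following vehicle,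
the safety ratio `σ(t) = (x₁(t) − x₂(t))/D(v₁(t), v₂(t))` is differentiable with
`σ'(t) = (v₁(t) − v₂(t))/L > 0`, i.e. it is strictly increasing. -/
theorem safety_ratio_increases_when_leader_faster
    (um L : ℝ) (hum : um < 0) (hL : 0 < L)
    (t : ℝ) (x₁ x₂ v₁ v₂ : ℝ → ℝ)
    (hx₁ : HasDerivAt x₁ (v₁ t) t) (hx₂ : HasDerivAt x₂ (v₂ t) t)
    (hv₁cont : ContinuousAt v₁ t) (hv₂cont : ContinuousAt v₂ t)
    (hv₂ : 0 ≤ v₂ t) (hv : v₂ t < v₁ t) :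
    HasDerivAt (fun s => (x₁ s - x₂ s) / Dsafe um L (v₁ s) (v₂ s))
      ((v₁ t - v₂ t) / L) t ∧ 0 < (v₁ t - v₂ t) / L := by
  have hsq : ∀ᶠ s in nhds t, v₂ s ^ 2 < v₁ s ^ 2 :=
    (hv₂cont.pow 2).eventually_lt (hv₁cont.pow 2) (pow_lt_pow_left₀ hv hv₂ two_ne_zero)
  have hD : ∀ᶠ s in nhds t, Dsafe um L (v₁ s) (v₂ s) = L := by
    filter_upwards [hsq] with s hs
    have h : (v₂ s ^ 2 - v₁ s ^ 2) / (-2 * um) ≤ 0 :=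
      div_nonpos_of_nonpos_of_nonneg (by linarith) (by linarith)
    rw [Dsafe, max_eq_left h, add_zero]
  refine ⟨((hx₁.sub hx₂).div_const L).congr_of_eventuallyEq ?_, div_pos (sub_pos.mpr hv) hL⟩
  filter_upwards [hD] with s hs
  simp [hs]
end

section
/- Let u_M > 0, ν ≥ 0, v ≥ 0, and t₀ ≤ t₁. Let w : [t₀, t₁] → ℝ be differentiable with w(t₀) = v, w(t₁) ≥ ν, and such that w(t) ≥ 0 and w'(t) ≤ u_M for all t ∈ [t₀, t₁]. Then ∫_{t₀}^{t₁} w(t) dt ≥ (ν² − v²)/(2·u_M). That is, the distance traversed by a vehicle with nonnegative speed and acceleration at most u_M while its speed evolves from v to at least ν is at least (ν² − v²)/(2u_M). -/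
/-- the distance traversed by a vehicle with nonnegative speed and
acceleration at most `u_M` while its speed evolves from `v` to at least `ν` is at
least `(ν² − v²)/(2 u_M)`. -/
theorem distance_lower_bound_under_accel_limit
    (uM ν v t₀ t₁ : ℝ) (huM : 0 < uM) (hν : 0 ≤ ν) (hv : 0 ≤ v) (ht : t₀ ≤ t₁)
    (w w' : ℝ → ℝ)
    (hdiff : ∀ t ∈ Set.Icc t₀ t₁, HasDerivWithinAt w (w' t) (Set.Icc t₀ t₁) t)
    (hw₀ : w t₀ = v) (hw₁ : ν ≤ w t₁)
    (hwnn : ∀ t ∈ Set.Icc t₀ t₁, 0 ≤ w t)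
    (haccel : ∀ t ∈ Set.Icc t₀ t₁, w' t ≤ uM) :
    (ν ^ 2 - v ^ 2) / (2 * uM) ≤ ∫ t in t₀..t₁, w t := by
  have hcont : ContinuousOn w (Set.Icc t₀ t₁) := fun t ht => (hdiff t ht).continuousWithinAt
  have key : w t₁ ^ 2 / (2 * uM) - w t₀ ^ 2 / (2 * uM) ≤ ∫ t in t₀..t₁, w t := by
    refine intervalIntegral.sub_le_integral_of_hasDeriv_right_of_le
      (g := fun t => w t ^ 2 / (2 * uM)) (g' := fun t => w t * w' t / uM) ht
      ((hcont.pow 2).div_const _) (fun t ht => ?_)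
      hcont.integrableOn_Icc (fun t ht => ?_)
    · have hw : HasDerivAt w (w' t) t :=
        (hdiff t (Set.Ioo_subset_Icc_self ht)).hasDerivAt (Icc_mem_nhds ht.1 ht.2)
      refine (((hw.pow 2).div_const (2 * uM)).congr_deriv ?_).hasDerivWithinAt
      field_simp
      norm_num
      ring
    · have ht' := Set.Ioo_subset_Icc_self ht
      rw [div_le_iff₀ huM]
      exact mul_le_mul_of_nonneg_left (haccel t ht') (hwnn t ht')
  refine le_trans ?_ key
  rw [← sub_div, hw₀]
  gcongr
end
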